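/- Assume V⁺ ∈ L¹ and assumption (i): ℙ{V(ω,z) ≥ 0} = 1 for all z ∈ R₀ and there exists c ∈ ℝ with ℙ{V(ω,z) ≥ c} = 1 for all z ∈ R∖R₀. Fix a face A ≠ {0} of C₊, let R' = R ∩ A, and assume V⁺(·,z) ∈ L_{z,R'} for each z ∈ R'∖{0} and V⁺(·,0) ∈ L_{ẑ,R'} for some ẑ ∈ R'∖{0}. Let I_A denote the σ-algebra of events invariant under T_x for all x ∈ G(R'), and let α be the process on relint A characterized ℙ-a.s. by α(ξ) = lim_{n→∞} a(0,x_n)/n for every ξ ∈ relint A and every sequence x_n ∈ G₊ ∩ A with x_n/n → ξ. Then for every B ∈ K⁺_A(V), with ℙ-probability one the following holds: for every ξ ∈ relint A and every representation ξ = Σ_{z∈R'} γ_z z with γ_z ∈ ℝ₊, one has α(ξ) ≥ − Σ_{z∈R'} γ_z E[B(·,0,z) | I_A]. -/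

import Mathlib

open MeasureTheory Filter Set
open scoped ENNReal NNReal Classical Topology

noncomputable section

namespace RWRP

abbrev Zd (d : ℕ) := Fin d → ℤ

variable {d : ℕ} {Ω : Type*} {Γ : Type*}

/-- Embedding of `ℤ^d` into `ℝ^d`. -/
def toR (x : Zd d) : Fin d → ℝ := fun i => (x i : ℝ)

/-- The `ℓ¹` norm on `ℝ^d`. -/
def n1 (ξ : Fin d → ℝ) : ℝ := ∑ i, |ξ i|

/-- The `ℓ¹` norm of a lattice point. -/
def n1Z (x : Zd d) : ℝ := n1 (toR x)

/-- `G₊`: the additive semigroup (ℤ₊-combinations) generated by the step set. -/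
def Gp (R : Finset (Zd d)) : Set (Zd d) := {x | ∃ b : Zd d → ℕ, x = ∑ z ∈ R, b z • z}

/-- `G(R')`: the additive group (ℤ-combinations) generated by `R'`. -/
def GZ (R : Finset (Zd d)) : Set (Zd d) := {x | ∃ b : Zd d → ℤ, x = ∑ z ∈ R, b z • z}

/-- ℤ₊-combinations of elements of a set of lattice points. -/
def GpS (S : Set (Zd d)) : Set (Zd d) :=
  {x | ∃ (m : ℕ) (c : Fin m → Zd d), (∀ i, c i ∈ S) ∧ x = ∑ i, c i}

/-- `C₊`: the real cone generated by the step set. -/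
def Cp (R : Finset (Zd d)) : Set (Fin d → ℝ) :=
  {ξ | ∃ b : Zd d → ℝ, (∀ z, 0 ≤ b z) ∧ ξ = ∑ z ∈ R, b z • toR z}

/-- `C'₊`: the rational cone generated by the step set. -/
def CpQ (R : Finset (Zd d)) : Set (Fin d → ℝ) :=
  {ξ | ∃ b : Zd d → ℚ, (∀ z, 0 ≤ b z) ∧ ξ = ∑ z ∈ R, (b z : ℝ) • toR z}

/-- `A` is a face of the convex set `K`. -/
def IsFace (K A : Set (Fin d → ℝ)) : Prop :=
  A ⊆ K ∧ Convex ℝ A ∧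
    ∀ ⦃ξ ζ η : Fin d → ℝ⦄ ⦃t : ℝ⦄, ξ ∈ A → ζ ∈ K → η ∈ K → t ∈ Set.Ioo (0:ℝ) 1 →
      ξ = t • ζ + (1 - t) • η → ζ ∈ A ∧ η ∈ A

/-- `U`: the convex hull of the step set. -/
def hullU (R : Finset (Zd d)) : Set (Fin d → ℝ) := convexHull ℝ (toR '' (R : Set (Zd d)))

/-- `U₀` is the face of `U` containing `0` in its relative interior (the empty set if `0 ∉ U`). -/
def IsZeroFace (R : Finset (Zd d)) (U₀ : Set (Fin d → ℝ)) : Prop :=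
  ((0 : Fin d → ℝ) ∈ hullU R ∧ IsFace (hullU R) U₀ ∧
    (0 : Fin d → ℝ) ∈ intrinsicInterior ℝ U₀) ∨
  ((0 : Fin d → ℝ) ∉ hullU R ∧ U₀ = ∅)

/-- `R₀ = R ∩ U₀`. -/
def R0 (R : Finset (Zd d)) (U₀ : Set (Fin d → ℝ)) : Set (Zd d) := {z | z ∈ R ∧ toR z ∈ U₀}

/-- `A_δ`: the directions in the face `A` at ℓ¹ distance `≥ δ` (after normalization) from the
relative boundary of `A`. -/
def faceDelta (A : Set (Fin d → ℝ)) (δ : ℝ) : Set (Fin d → ℝ) :=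
  {ξ | ξ ∈ A ∧ ξ ≠ 0 ∧
    ENNReal.ofReal δ ≤ ⨅ (η : Fin d → ℝ) (_ : η ∈ A \ intrinsicInterior ℝ A),
      ENNReal.ofReal (n1 ((n1 ξ)⁻¹ • ξ - η))}

/-- `U'_δ = {ξ ∈ U' : dist(ξ, U' ∖ relint Uall) ≥ δ}`. -/
def faceDeltaU (Uall U' : Set (Fin d → ℝ)) (δ : ℝ) : Set (Fin d → ℝ) :=
  {ξ | ξ ∈ U' ∧
    ENNReal.ofReal δ ≤ ⨅ (η : Fin d → ℝ) (_ : η ∈ U' \ intrinsicInterior ℝ Uall),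
      ENNReal.ofReal (n1 (ξ - η))}

/-- `D_n`: points reachable in exactly `n` admissible steps (counted with multiplicities). -/
def Dn (R : Finset (Zd d)) (n : ℕ) : Set (Zd d) :=
  {x | ∃ b : Zd d → ℕ, (∑ z ∈ R, b z) = n ∧ x = ∑ z ∈ R, b z • z}

/-- Position after `k` steps of the path with increments `f`, started at `x`. -/
def pos (x : Zd d) (f : ℕ → Zd d) (k : ℕ) : Zd d := x + ∑ i ∈ Finset.range k, f i

/-- Convert a finite tuple of admissible steps to an increment sequence. -/
def stepF {R : Finset (Zd d)} (n : ℕ) (s : Fin n → {z : Zd d // z ∈ R}) : ℕ → Zd d :=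
  fun i => if h : i < n then (s ⟨i, h⟩ : Zd d) else 0

/-- The path started at `x` with increments `f` hits `y` for the first time (after time `0`)
at time `n`. -/
def firstHit (x y : Zd d) (n : ℕ) (f : ℕ → Zd d) : Prop :=
  pos x f n = y ∧ ∀ k ∈ Finset.Ioo 0 n, pos x f k ≠ y

/-- Probability weight of a tuple of steps under the random walk kernel `p`. -/
def pathW (p : Zd d → ℝ) {R : Finset (Zd d)} {n : ℕ} (s : Fin n → {z : Zd d // z ∈ R}) : ℝ≥0∞ :=
  ∏ i, ENNReal.ofReal (p (s i : Zd d))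

/-- Total potential collected along the first `n` steps of a path. -/
def pathV (T : Zd d → Ω → Ω) (V : Ω → Zd d → ℝ) (ω : Ω) (x : Zd d) (n : ℕ)
    (f : ℕ → Zd d) : ℝ :=
  ∑ i ∈ Finset.range n, V (T (pos x f i) ω) (f i)

/-- `E_x[exp(-∑_{k<τ_y} V(T_{X_k}ω, Z_{k+1})) 1{τ_y < ∞}]`, as a sum over killed paths. -/
def walkK (T : Zd d → Ω → Ω) (V : Ω → Zd d → ℝ) (p : Zd d → ℝ) (R : Finset (Zd d))
    (ω : Ω) (x y : Zd d) : ℝ≥0∞ :=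
  ∑' n : ℕ, ∑ s : Fin (n+1) → {z : Zd d // z ∈ R},
    if firstHit x y (n+1) (stepF (n+1) s) then
      pathW p s * ENNReal.ofReal (Real.exp (-(pathV T V ω x (n+1) (stepF (n+1) s))))
    else 0

/-- The point-to-point quantity `a(ω,x,y)` (real-valued version, with junk values where the
underlying expectation is `0` or `∞`). -/
def aFun (T : Zd d → Ω → Ω) (V : Ω → Zd d → ℝ) (p : Zd d → ℝ) (R : Finset (Zd d))
    (ω : Ω) (x y : Zd d) : ℝ :=
  if y = x then 0 else - Real.log ((walkK T V p R ω x y).toReal)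

/-- The point-to-point quantity `a(ω,x,y)` with values in `[-∞,∞]`. -/
def aE (T : Zd d → Ω → Ω) (V : Ω → Zd d → ℝ) (p : Zd d → ℝ) (R : Finset (Zd d))
    (ω : Ω) (x y : Zd d) : EReal :=
  if y = x then (0 : EReal) else - (ENNReal.log (walkK T V p R ω x y))

/-- The zero-temperature quantity `a_∞(ω,x,y)`: the infimum of the total potential over
admissible paths from `x` to `y` that hit `y` for the first time at their last step. -/
def aInf (T : Zd d → Ω → Ω) (V : Ω → Zd d → ℝ) (R : Finset (Zd d))
    (ω : Ω) (x y : Zd d) : ℝ :=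
  if y = x then 0 else
    sInf {v : ℝ | ∃ n : ℕ, ∃ s : Fin (n+1) → {z : Zd d // z ∈ R},
      firstHit x y (n+1) (stepF (n+1) s) ∧ v = pathV T V ω x (n+1) (stepF (n+1) s)}

/-- The Green's function `g(ω,x,y)`, with values in `[0,∞]`. -/
def greenK (T : Zd d → Ω → Ω) (V : Ω → Zd d → ℝ) (p : Zd d → ℝ) (R : Finset (Zd d))
    (ω : Ω) (x y : Zd d) : ℝ≥0∞ :=
  (if y = x then 1 else 0) +
  ∑' n : ℕ, ∑ s : Fin (n+1) → {z : Zd d // z ∈ R},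
    if pos x (stepF (n+1) s) (n+1) = y then
      pathW p s * ENNReal.ofReal (Real.exp (-(pathV T V ω x (n+1) (stepF (n+1) s))))
    else 0

/-- `E_x[exp(-∑_{k<n} V) 1{X_n = y}]`: the restricted-length partition function. -/
def resK (T : Zd d → Ω → Ω) (V : Ω → Zd d → ℝ) (p : Zd d → ℝ) (R : Finset (Zd d))
    (ω : Ω) (n : ℕ) (x y : Zd d) : ℝ≥0∞ :=
  ∑ s : Fin n → {z : Zd d // z ∈ R},
    if pos x (stepF n s) n = y then
      pathW p s * ENNReal.ofReal (Real.exp (-(pathV T V ω x n (stepF n s))))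
    else 0

/-- `G_{x,(n),y} = log E_x[exp(-∑_{k<n} V) 1{X_n = y}]`. -/
def GRes (T : Zd d → Ω → Ω) (V : Ω → Zd d → ℝ) (p : Zd d → ℝ) (R : Finset (Zd d))
    (ω : Ω) (n : ℕ) (x y : Zd d) : ℝ :=
  Real.log ((resK T V p R ω n x y).toReal)

/-- The return probability `P₀(τ₀ < ∞)` of the reference walk. -/
def retP (p : Zd d → ℝ) (R : Finset (Zd d)) : ℝ≥0∞ :=
  ∑' n : ℕ, ∑ s : Fin (n+1) → {z : Zd d // z ∈ R},
    if firstHit (0 : Zd d) 0 (n+1) (stepF (n+1) s) then pathW p s else 0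

/-- `R_ε`: the ℓ¹-distance from the origin to the nearest point `x` of `G₊(S)` with
`V(T_x ω, z) ≥ ε` for some `z ∈ S`, as an element of `[0,∞]`. -/
def Reps (T : Zd d → Ω → Ω) (V : Ω → Zd d → ℝ) (S : Set (Zd d)) (ε : ℝ) (ω : Ω) : ℝ≥0∞ :=
  ⨅ (x : Zd d) (_ : x ∈ GpS S ∧ ∃ z ∈ S, ε ≤ V (T x ω) z), ENNReal.ofReal (n1Z x)

/-- The shift maps on a product space. -/
def shiftT (z : Zd d) (ω : Zd d → Γ) : Zd d → Γ := fun y => ω (z + y)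

/-- A function is locally Lipschitz (w.r.t. the ℓ¹ norm) on a set. -/
def LocLipOn (f : (Fin d → ℝ) → ℝ) (S : Set (Fin d → ℝ)) : Prop :=
  ∀ ξ ∈ S, ∃ K ε : ℝ, 0 < ε ∧ ∀ x ∈ S, ∀ y ∈ S,
    n1 (x - ξ) < ε → n1 (y - ξ) < ε → |f x - f y| ≤ K * n1 (x - y)

section measurable

variable [MeasurableSpace Ω]

/-- The σ-algebra of measurable sets invariant under the shifts `{T_z : z ∈ S}`. -/
def invSigma (T : Zd d → Ω → Ω) (S : Set (Zd d)) : MeasurableSpace Ω where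
  MeasurableSet' A := MeasurableSet A ∧ ∀ z ∈ S, T z ⁻¹' A = A
  measurableSet_empty := ⟨MeasurableSet.empty, fun _ _ => by simp⟩
  measurableSet_compl A hA := ⟨hA.1.compl, fun z hz => by
    rw [Set.preimage_compl, hA.2 z hz]⟩
  measurableSet_iUnion f hf := ⟨MeasurableSet.iUnion fun i => (hf i).1, fun z hz => by
    rw [Set.preimage_iUnion]
    exact Set.iUnion_congr fun i => (hf i).2 z hz⟩

/-- `ℙ` is ergodic under the shifts `{T_z : z ∈ S}`. -/
def ErgodicUnder (ℙ : Measure Ω) (T : Zd d → Ω → Ω) (S : Set (Zd d)) : Prop :=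
  ∀ A : Set Ω, MeasurableSet A → (∀ z ∈ S, T z ⁻¹' A = A) → ℙ A = 0 ∨ ℙ A = 1

/-- The class `𝓛_{z,R'}`. -/
def classL (ℙ : Measure Ω) (T : Zd d → Ω → Ω) (g : Ω → ℝ) (z : Zd d)
    (R' : Finset (Zd d)) : Prop :=
  ∀ᵐ ω ∂ℙ,
    (⨅ ε : {e : ℝ // 0 < e},
      Filter.limsup (fun n : ℕ =>
        ⨆ (x : Zd d) (_ : x ∈ Gp R' ∧ n1Z x ≤ n),
          (n : ℝ≥0∞)⁻¹ *
            ∑ k ∈ Finset.range (⌊(ε : ℝ) * n⌋₊ + 1), ENNReal.ofReal (g (T (x + k • z) ω)))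
        Filter.atTop) = 0

/-- Extended conditional expectation, with values in `[-∞,∞]`: the decreasing limit of the
conditional expectations of the truncations `max f (-n)`.  It agrees a.s. with the usual
conditional expectation in `[-∞,∞)` whenever `f⁺` is integrable. -/
def condExpE (ℙ : Measure Ω) (m : MeasurableSpace Ω) (f : Ω → ℝ) : Ω → EReal :=
  fun ω => ⨅ n : ℕ, ((MeasureTheory.condExp m ℙ (fun ω' => max (f ω') (-(n : ℝ))) ω : ℝ) : EReal)

/-- `EReal → ℝ≥0∞`, sending `[-∞,0]` to `0` and `⊤` to `⊤`. -/
def erealToENN (x : EReal) : ℝ≥0∞ := if x = ⊤ then ⊤ else ENNReal.ofReal x.toReal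

/-- `ᾱ(x) = inf_{n ≥ 1} (1/n) E[a(0,nx) | I_x]`, with `ᾱ(0) = 0`. -/
def alphaBar (ℙ : Measure Ω) (T : Zd d → Ω → Ω) (V : Ω → Zd d → ℝ) (p : Zd d → ℝ)
    (R : Finset (Zd d)) (x : Zd d) : Ω → EReal :=
  fun ω =>
    if x = 0 then 0 else
    ⨅ n : {m : ℕ // 0 < m},
      (((n : ℕ) : ℝ)⁻¹ : EReal) *
        condExpE ℙ (invSigma T {x}) (fun ω' => aFun T V p R ω' 0 ((n : ℕ) • x)) ω

/-- `x̂_t(ξ) = ∑_z ⌊tγ_z⌋ z`. -/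
def xhat (R : Finset (Zd d)) (γ : Zd d → ℝ) (t : ℝ) : Zd d := ∑ z ∈ R, ⌊t * γ z⌋ • z

/-- `tilde-α(ξ) = inf_{t ∈ ℚ, t>0} (1/t) E[a(0, x̂_t(ξ)) | 𝔖]`, where `𝔖` is the σ-algebra of
sets invariant under the shifts from `S`. -/
def tAlpha (ℙ : Measure Ω) (T : Zd d → Ω → Ω) (V : Ω → Zd d → ℝ) (p : Zd d → ℝ)
    (R : Finset (Zd d)) (S : Set (Zd d)) (γ : Zd d → ℝ) : Ω → EReal :=
  fun ω => ⨅ t : {q : ℚ // 0 < q},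
    ((((t : ℚ) : ℝ))⁻¹ : EReal) *
      condExpE ℙ (invSigma T S) (fun ω' => aFun T V p R ω' 0 (xhat R γ ((t : ℚ) : ℝ))) ω

/-- The σ-algebra `𝔖_ξ` of sets invariant under the shifts from `R_ξ = R ∩ C_ξ`. -/
def Sface (T : Zd d → Ω → Ω) (R : Finset (Zd d))
    (Cface : (Fin d → ℝ) → Set (Fin d → ℝ)) (ξ : Fin d → ℝ) : MeasurableSpace Ω :=
  invSigma T {z | z ∈ R ∧ toR z ∈ Cface ξ}

/-- `tilde-α` as a function of the direction `ξ`, given a choice `Cface` of the face `C_ξ`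
and a choice `γfun` of cone coefficients. -/
def tAlphaF (ℙ : Measure Ω) (T : Zd d → Ω → Ω) (V : Ω → Zd d → ℝ) (p : Zd d → ℝ)
    (R : Finset (Zd d)) (Cface : (Fin d → ℝ) → Set (Fin d → ℝ))
    (γfun : (Fin d → ℝ) → Zd d → ℝ) (ξ : Fin d → ℝ) : Ω → EReal :=
  fun ω => if ξ = 0 then 0 else tAlpha ℙ T V p R {z | z ∈ R ∧ toR z ∈ Cface ξ} (γfun ξ) ω

/-- `B` is an `L¹` covariant cocycle on the group generated by the allowed steps. -/
def IsCocycle (ℙ : Measure Ω) (T : Zd d → Ω → Ω) (S : Set (Zd d))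
    (B : Ω → Zd d → Zd d → ℝ) : Prop :=
  (∀ x y : Zd d, Measurable fun ω => B ω x y) ∧
  (∀ x ∈ S, ∀ y ∈ S, Integrable (fun ω => B ω x y) ℙ) ∧
  (∀ᵐ ω ∂ℙ, ∀ x ∈ S, ∀ y ∈ S, ∀ z ∈ S, B ω x y + B ω y z = B ω x z) ∧
  (∀ᵐ ω ∂ℙ, ∀ x ∈ S, ∀ y ∈ S, ∀ z ∈ S, B ω (x + z) (y + z) = B (T z ω) x y)

/-- The class `K⁺_A(V)` of centered cocycles. -/
def InKplus (ℙ : Measure Ω) (T : Zd d → Ω → Ω) (V : Ω → Zd d → ℝ) (p : Zd d → ℝ)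
    (R' : Finset (Zd d)) (B : Ω → Zd d → Zd d → ℝ) : Prop :=
  IsCocycle ℙ T (GZ R') B ∧
  ∀ᵐ ω ∂ℙ, ∑ z ∈ R', p z * Real.exp (-(V ω z) - B ω 0 z) ≤ 1

/-- The standing setting: shifts, stationary `ℙ`, finite step set, measurable potential,
random walk kernel. -/
def Setting (ℙ : Measure Ω) (T : Zd d → Ω → Ω) (R : Finset (Zd d))
    (V : Ω → Zd d → ℝ) (p : Zd d → ℝ) : Prop :=
  (∀ z : Zd d, Measurable (T z)) ∧ T 0 = id ∧ (∀ x y : Zd d, T (x + y) = T x ∘ T y) ∧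
  (∀ z : Zd d, MeasurePreserving (T z) ℙ ℙ) ∧ 2 ≤ R.card ∧
  (∀ z : Zd d, Measurable fun ω => V ω z) ∧
  (∀ z ∈ R, 0 < p z ∧ p z < 1) ∧ ∑ z ∈ R, p z = 1

/-- `V⁺ ∈ L¹`. -/
def VplusL1 (ℙ : Measure Ω) (V : Ω → Zd d → ℝ) (R : Finset (Zd d)) : Prop :=
  ∀ z ∈ R, Integrable (fun ω => max (V ω z) 0) ℙ

/-- Assumption (i): `V ≥ 0` a.s. on `R₀` and `V ≥ c` a.s. on `R ∖ R₀`. -/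
def AssumptionI (ℙ : Measure Ω) (V : Ω → Zd d → ℝ) (R : Finset (Zd d))
    (U₀ : Set (Fin d → ℝ)) : Prop :=
  (∀ z ∈ R0 R U₀, ∀ᵐ ω ∂ℙ, 0 ≤ V ω z) ∧
  ∃ c : ℝ, ∀ z ∈ R, toR z ∉ U₀ → ∀ᵐ ω ∂ℙ, c ≤ V ω z

end measurable

end RWRP

namespace RWRPProof
open RWRP

theorem l1_ergodic {Ω : Type*} [MeasurableSpace Ω] (μ : Measure Ω) [IsProbabilityMeasure μ]
    (S : Ω → Ω) (hS : MeasurePreserving S μ μ) (f : Lp ℝ 1 μ) :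
    ∃ L : Lp ℝ 1 μ, Tendsto (fun n : ℕ => birkhoffAverage ℝ
      (Lp.compMeasurePreserving (E := ℝ) (p := 1) S hS) _root_.id n f) atTop (𝓝 L) := by
  have hlip : LipschitzWith 1 (Lp.compMeasurePreserving (E := ℝ) (p := 1) S hS) :=
    (Lp.isometry_compMeasurePreserving hS).lipschitz
  have hbd : ∀ (n : ℕ) (x y : Lp ℝ 1 μ),
      dist (birkhoffAverage ℝ (Lp.compMeasurePreserving (E := ℝ) (p := 1) S hS) _root_.id n x)
        (birkhoffAverage ℝ (Lp.compMeasurePreserving (E := ℝ) (p := 1) S hS) _root_.id n y)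
        ≤ dist x y := by
    intro n x y
    refine (dist_birkhoffAverage_birkhoffAverage_le ℝ _ _ n x y).trans ?_
    have h : ∀ k ∈ Finset.range n,
        dist (_root_.id ((Lp.compMeasurePreserving (E := ℝ) (p := 1) S hS)^[k] x))
          (_root_.id ((Lp.compMeasurePreserving (E := ℝ) (p := 1) S hS)^[k] y)) ≤ dist x y := by
      intro k _
      have := (hlip.iterate k).dist_le_mul x y
      simpa using this
    have h2 := Finset.sum_le_sum h
    simp only [Finset.sum_const, Finset.card_range, nsmul_eq_mul] at h2
    rcases Nat.eq_zero_or_pos n with hn | hn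
    · subst hn; simp
    · have hn' : (0:ℝ) < n := by exact_mod_cast hn
      rw [div_le_iff₀ hn']
      linarith
  apply cauchySeq_tendsto_of_complete
  rw [Metric.cauchySeq_iff']
  intro ε hε
  have hden := (Lp.simpleFunc.dense (E := ℝ) (p := 1) (μ := μ) (by simp)) f
  rw [Metric.mem_closure_iff] at hden
  obtain ⟨g, hg, hfg⟩ := hden (ε / 4) (by linarith)
  have hg2 : (g : Ω →ₘ[μ] ℝ) ∈ Lp ℝ 2 μ := by
    obtain ⟨s, hs⟩ := hg
    have hm : MemLp s 2 μ := SimpleFunc.memLp_of_isFiniteMeasure s 2 μ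
    have := (hm.toLp s).2
    rw [← hs]
    exact this
  set g2 : Lp ℝ 2 μ := ⟨g.1, hg2⟩ with hg2def
  let J : Lp ℝ 2 μ →+ Lp ℝ 1 μ := AddSubgroup.inclusion (Lp.antitone (by norm_num))
  have hJn : ∀ h, ‖J h‖ ≤ ‖h‖ := by
    intro h
    rw [Lp.norm_def, Lp.norm_def]
    refine ENNReal.toReal_mono (Lp.eLpNorm_ne_top h) ?_
    exact eLpNorm_le_eLpNorm_of_exponent_le (by norm_num) (Lp.aestronglyMeasurable h)
  have hJK : ∀ h, J (Lp.compMeasurePreserving (E := ℝ) (p := 2) S hS h) =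
      Lp.compMeasurePreserving (E := ℝ) (p := 1) S hS (J h) := fun h => rfl
  have hJi : ∀ (k : ℕ) h, J ((Lp.compMeasurePreserving (E := ℝ) (p := 2) S hS)^[k] h) =
      (Lp.compMeasurePreserving (E := ℝ) (p := 1) S hS)^[k] (J h) := by
    intro k
    induction k with
    | zero => intro h; rfl
    | succ k ih => intro h; rw [Function.iterate_succ_apply, Function.iterate_succ_apply, ih, hJK]
  have hJs : ∀ (c : ℝ) h, J (c • h) = c • J h := fun c h => rfl
  have hJa : ∀ (n : ℕ) h, J (birkhoffAverage ℝ
      (Lp.compMeasurePreserving (E := ℝ) (p := 2) S hS) _root_.id n h) = birkhoffAverage ℝ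
      (Lp.compMeasurePreserving (E := ℝ) (p := 1) S hS) _root_.id n (J h) := by
    intro n h
    simp only [birkhoffAverage, birkhoffSum, hJs, map_sum, _root_.id, hJi]
  have hJg : J g2 = g := rfl
  have hc2 := (ContinuousLinearMap.tendsto_birkhoffAverage_orthogonalProjection
    (𝕜 := ℝ) (E := Lp ℝ 2 μ)
    (Lp.compMeasurePreservingₗᵢ (E := ℝ) (p := 2) ℝ S hS).toContinuousLinearMap
    (LinearIsometry.norm_toContinuousLinearMap_le _) g2).cauchySeq
  rw [Metric.cauchySeq_iff'] at hc2
  obtain ⟨N, hN⟩ := hc2 (ε / 4) (by linarith)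
  refine ⟨N, fun n hn => ?_⟩
  have h1 := hN n hn
  have h2 : dist (birkhoffAverage ℝ
      (Lp.compMeasurePreserving (E := ℝ) (p := 1) S hS) _root_.id n g) (birkhoffAverage ℝ
      (Lp.compMeasurePreserving (E := ℝ) (p := 1) S hS) _root_.id N g) < ε / 4 := by
    refine lt_of_le_of_lt ?_ h1
    rw [← hJg, ← hJa, ← hJa, dist_eq_norm, dist_eq_norm, ← map_sub]
    exact hJn _
  have h3 := hbd n f g
  have h4 := hbd N g f
  rw [dist_comm g f] at h4
  have := dist_triangle4 (birkhoffAverage ℝ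
      (Lp.compMeasurePreserving (E := ℝ) (p := 1) S hS) _root_.id n f) (birkhoffAverage ℝ
      (Lp.compMeasurePreserving (E := ℝ) (p := 1) S hS) _root_.id n g) (birkhoffAverage ℝ
      (Lp.compMeasurePreserving (E := ℝ) (p := 1) S hS) _root_.id N g) (birkhoffAverage ℝ
      (Lp.compMeasurePreserving (E := ℝ) (p := 1) S hS) _root_.id N f)
  linarith

section comb
variable {d : ℕ} {Ω : Type*}

theorem GZ_zero (R : Finset (Zd d)) : (0 : Zd d) ∈ GZ R := ⟨0, by simp⟩

theorem GZ_add {R : Finset (Zd d)} {x y : Zd d} (hx : x ∈ GZ R) (hy : y ∈ GZ R) :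
    x + y ∈ GZ R := by
  obtain ⟨b, rfl⟩ := hx
  obtain ⟨c, rfl⟩ := hy
  exact ⟨b + c, by simp [add_smul, Finset.sum_add_distrib]⟩

theorem GZ_neg {R : Finset (Zd d)} {x : Zd d} (hx : x ∈ GZ R) : -x ∈ GZ R := by
  obtain ⟨b, rfl⟩ := hx
  exact ⟨-b, by simp⟩

theorem Gp_zero (R : Finset (Zd d)) : (0 : Zd d) ∈ Gp R := ⟨0, by simp⟩

theorem Gp_add {R : Finset (Zd d)} {x y : Zd d} (hx : x ∈ Gp R) (hy : y ∈ Gp R) :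
    x + y ∈ Gp R := by
  obtain ⟨b, rfl⟩ := hx
  obtain ⟨c, rfl⟩ := hy
  exact ⟨b + c, by simp [add_smul, Finset.sum_add_distrib]⟩

theorem Gp_mem {R : Finset (Zd d)} {z : Zd d} (hz : z ∈ R) : z ∈ Gp R :=
  ⟨fun w => if w = z then 1 else 0, by simp [ite_smul, hz]⟩

theorem Gp_sub_GZ {R : Finset (Zd d)} {x : Zd d} (hx : x ∈ Gp R) : x ∈ GZ R := by
  obtain ⟨b, rfl⟩ := hx
  exact ⟨fun z => b z, by simp⟩

theorem Gp_sum {R : Finset (Zd d)} {ι : Type*} (s : Finset ι) (f : ι → Zd d)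
    (h : ∀ i ∈ s, f i ∈ Gp R) : ∑ i ∈ s, f i ∈ Gp R := by
  induction s using Finset.induction_on with
  | empty => simpa using Gp_zero R
  | insert a s ha ih =>
    rw [Finset.sum_insert ha]
    exact Gp_add (h _ (by simp)) (ih fun i hi => h i (by simp [hi]))

theorem Gp_nsmul {R : Finset (Zd d)} {x : Zd d} (hx : x ∈ Gp R) (n : ℕ) : n • x ∈ Gp R := by
  induction n with
  | zero => simpa using Gp_zero R
  | succ n ih => rw [succ_nsmul]; exact Gp_add ih hx

theorem Gp_mono {R R' : Finset (Zd d)} (h : R' ⊆ R) {x : Zd d} (hx : x ∈ Gp R') : x ∈ Gp R := by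
  obtain ⟨b, rfl⟩ := hx
  exact Gp_sum _ _ fun i hi => Gp_nsmul (Gp_mem (h hi)) _

theorem Gp_induction {R : Finset (Zd d)} {P : Zd d → Prop} (h0 : P 0)
    (hs : ∀ x, P x → ∀ z ∈ R, P (x + z)) {x : Zd d} (hx : x ∈ Gp R) : P x := by
  obtain ⟨b, rfl⟩ := hx
  have key : ∀ s : Finset (Zd d), s ⊆ R → P (∑ z ∈ s, b z • z) := by
    intro s
    induction s using Finset.induction_on with
    | empty => intro _; simpa using h0
    | insert a s ha ih =>
      intro hsR
      rw [Finset.sum_insert ha, add_comm]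
      have h1 := ih fun i hi => hsR (by simp [hi])
      have haR : a ∈ R := hsR (by simp)
      generalize b a = m
      induction m with
      | zero => simpa using h1
      | succ m ih2 =>
        rw [succ_nsmul, ← add_assoc]
        exact hs _ ih2 _ haR
  exact key R subset_rfl

/-- one term of the series `walkK` -/
def wT (T : Zd d → Ω → Ω) (V : Ω → Zd d → ℝ) (p : Zd d → ℝ) (R : Finset (Zd d))
    (ω : Ω) (y : Zd d) (n : ℕ) (x : Zd d) : ℝ≥0∞ :=
  ∑ s : Fin (n+1) → {z : Zd d // z ∈ R},
    if firstHit x y (n+1) (stepF (n+1) s) then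
      pathW p s * ENNReal.ofReal (Real.exp (-(pathV T V ω x (n+1) (stepF (n+1) s))))
    else 0

/-- one-step weight -/
def cW (T : Zd d → Ω → Ω) (V : Ω → Zd d → ℝ) (p : Zd d → ℝ)
    (ω : Ω) (x z : Zd d) : ℝ≥0∞ :=
  ENNReal.ofReal (p z) * ENNReal.ofReal (Real.exp (-(V (T x ω) z)))

theorem stepF_cons_zero {R : Finset (Zd d)} (n : ℕ) (z : {z : Zd d // z ∈ R})
    (s : Fin n → {z : Zd d // z ∈ R}) :
    stepF (n+1) (Fin.cons z s : Fin (n+1) → {z : Zd d // z ∈ R}) 0 = z := by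
  simp [stepF]

theorem stepF_cons_succ {R : Finset (Zd d)} (n : ℕ) (z : {z : Zd d // z ∈ R})
    (s : Fin n → {z : Zd d // z ∈ R}) (i : ℕ) :
    stepF (n+1) (Fin.cons z s : Fin (n+1) → {z : Zd d // z ∈ R}) (i+1) = stepF n s i := by
  unfold stepF
  by_cases h : i < n
  · rw [dif_pos h, dif_pos (by omega)]
    have : (⟨i+1, by omega⟩ : Fin (n+1)) = Fin.succ ⟨i, h⟩ := rfl
    rw [this, Fin.cons_succ]
  · rw [dif_neg h, dif_neg (by omega)]

theorem pos_succ' (x : Zd d) (f : ℕ → Zd d) (k : ℕ) :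
    pos x f (k+1) = pos (x + f 0) (fun i => f (i+1)) k := by
  unfold pos
  rw [Finset.sum_range_succ']
  abel

theorem pathV_succ' (T : Zd d → Ω → Ω) (V : Ω → Zd d → ℝ) (ω : Ω) (x : Zd d) (n : ℕ)
    (f : ℕ → Zd d) :
    pathV T V ω x (n+1) f =
      V (T x ω) (f 0) + pathV T V ω (x + f 0) n (fun i => f (i+1)) := by
  unfold pathV
  rw [Finset.sum_range_succ', add_comm]
  congr 1
  · simp [pos]
  · simp only [pos_succ']

theorem firstHit_succ' (x y : Zd d) (n : ℕ) (f : ℕ → Zd d) :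
    firstHit x y (n+2) f ↔
      (x + f 0 ≠ y ∧ firstHit (x + f 0) y (n+1) (fun i => f (i+1))) := by
  unfold firstHit
  rw [pos_succ']
  constructor
  · rintro ⟨h1, h2⟩
    refine ⟨?_, h1, ?_⟩
    · have := h2 1 (by simp)
      simpa [pos] using this
    · intro k hk
      have := h2 (k+1) (by simp at hk ⊢; omega)
      rwa [pos_succ'] at this
  · rintro ⟨h0, h1, h2⟩
    refine ⟨h1, ?_⟩
    intro k hk
    rcases k with _ | k
    · simp at hk
    rw [pos_succ']
    rcases k with _ | k
    · simpa [pos] using h0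
    · exact h2 (k+1) (by simp at hk ⊢; omega)

theorem sum_cons {R : Finset (Zd d)} (n : ℕ)
    (F : (Fin (n+1) → {z : Zd d // z ∈ R}) → ℝ≥0∞) :
    ∑ s, F s = ∑ z : {z : Zd d // z ∈ R}, ∑ s : Fin n → {z : Zd d // z ∈ R}, F (Fin.cons z s) := by
  rw [← Fintype.sum_prod_type']
  exact (Fintype.sum_equiv (Fin.consEquiv fun _ => {z : Zd d // z ∈ R}) _ _ (fun _ => rfl)).symm

theorem wT_zero (T : Zd d → Ω → Ω) (V : Ω → Zd d → ℝ) (p : Zd d → ℝ) (R : Finset (Zd d))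
    (ω : Ω) (y : Zd d) (x : Zd d) :
    wT T V p R ω y 0 x = ∑ z : {z : Zd d // z ∈ R},
      if x + (z : Zd d) = y then cW T V p ω x z else 0 := by
  unfold wT
  rw [sum_cons]
  refine Finset.sum_congr rfl fun z _ => ?_
  rw [Fintype.sum_unique]
  have h1 : firstHit x y (0+1) (stepF (0+1)
      (Fin.cons z default : Fin (0+1) → {z : Zd d // z ∈ R})) ↔ x + (z : Zd d) = y := by
    unfold firstHit
    rw [pos_succ', stepF_cons_zero]
    simp only [pos, Finset.range_zero, Finset.sum_empty, add_zero]
    refine ⟨fun h => h.1, fun h => ⟨h, fun k hk => ?_⟩⟩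
    have := Finset.mem_Ioo.1 hk
    omega
  simp only [h1]
  congr 1
  rw [pathV_succ', stepF_cons_zero]
  simp [pathW, pathV, cW]

theorem wT_succ (T : Zd d → Ω → Ω) (V : Ω → Zd d → ℝ) (p : Zd d → ℝ) (R : Finset (Zd d))
    (ω : Ω) (y : Zd d) (n : ℕ) (x : Zd d) :
    wT T V p R ω y (n+1) x = ∑ z : {z : Zd d // z ∈ R},
      if x + (z : Zd d) = y then 0 else cW T V p ω x z * wT T V p R ω y n (x + z) := by
  conv_lhs => unfold wT
  rw [sum_cons]
  refine Finset.sum_congr rfl fun z _ => ?_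
  have e : ∀ s : Fin (n+1) → {z : Zd d // z ∈ R}, (fun i => stepF (n+1+1)
      (Fin.cons z s : Fin (n+1+1) → {z : Zd d // z ∈ R}) (i+1)) = stepF (n+1) s := by
    intro s; funext i; exact stepF_cons_succ _ _ _ _
  by_cases h : x + (z : Zd d) = y
  · rw [if_pos h]
    refine Finset.sum_eq_zero fun s _ => ?_
    rw [if_neg]
    rw [firstHit_succ', stepF_cons_zero]
    tauto
  · rw [if_neg h, wT, Finset.mul_sum]
    refine Finset.sum_congr rfl fun s _ => ?_
    have h1 : firstHit x y (n+1+1) (stepF (n+1+1)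
      (Fin.cons z s : Fin (n+1+1) → {z : Zd d // z ∈ R})) ↔
        firstHit (x + (z : Zd d)) y (n+1) (stepF (n+1) s) := by
      rw [firstHit_succ', stepF_cons_zero, e]
      tauto
    simp only [h1, mul_ite, mul_zero]
    congr 1
    rw [pathV_succ', stepF_cons_zero, e, neg_add, Real.exp_add,
      ENNReal.ofReal_mul (Real.exp_nonneg _), cW]
    have : pathW p (Fin.cons z s : Fin (n+1+1) → {z : Zd d // z ∈ R}) =
      ENNReal.ofReal (p z) * pathW p s := by
      simp [pathW, Fin.prod_univ_succ]
    rw [this]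
    ring

theorem stepF_mem {R : Finset (Zd d)} (n : ℕ) (s : Fin n → {z : Zd d // z ∈ R}) {i : ℕ}
    (hi : i < n) : stepF n s i ∈ R := by
  unfold stepF
  rw [dif_pos hi]
  exact (s _).2

theorem wT_eq_zero (T : Zd d → Ω → Ω) (V : Ω → Zd d → ℝ) (p : Zd d → ℝ) (R : Finset (Zd d))
    (ω : Ω) (y : Zd d) (n : ℕ) (x : Zd d) (h : y - x ∉ Gp R) : wT T V p R ω y n x = 0 := by
  unfold wT
  refine Finset.sum_eq_zero fun s _ => ?_
  rw [if_neg]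
  rintro ⟨h1, -⟩
  apply h
  rw [← h1]
  unfold pos
  rw [add_sub_cancel_left]
  exact Gp_sum _ _ fun i hi => Gp_mem (stepF_mem _ _ (Finset.mem_range.1 hi))

theorem walk_bound (T : Zd d → Ω → Ω) (V : Ω → Zd d → ℝ) (p : Zd d → ℝ) (R R' : Finset (Zd d))
    (hR' : R' ⊆ R) (hp : ∀ z ∈ R, 0 ≤ p z)
    (ω : Ω) (y : Zd d)
    (hy : ∀ x ∈ Gp R', ∀ z ∈ R, z ∉ R' → y - (x + z) ∉ Gp R)
    (D : Zd d → ℝ) (hD : D y = 0)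
    (H : ∀ x ∈ Gp R', ∑ z ∈ R', p z * Real.exp (-(V (T x ω) z) + D (x + z)) ≤ Real.exp (D x)) :
    walkK T V p R ω 0 y ≤ ENNReal.ofReal (Real.exp (D 0)) := by
  have key : ∀ N : ℕ, ∀ x ∈ Gp R', ∑ n ∈ Finset.range N, wT T V p R ω y n x ≤
      ENNReal.ofReal (Real.exp (D x)) := by
    intro N
    induction N with
    | zero => intro x _; simp
    | succ N ih =>
      intro x hx
      rw [Finset.sum_range_succ', wT_zero]
      simp only [wT_succ]
      rw [Finset.sum_comm, ← Finset.sum_add_distrib]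
      have step : ∀ z : {z : Zd d // z ∈ R},
          (∑ n ∈ Finset.range N, if x + (z : Zd d) = y then 0 else
            cW T V p ω x z * wT T V p R ω y n (x + z)) +
          (if x + (z : Zd d) = y then cW T V p ω x z else 0) ≤
          if (z : Zd d) ∈ R' then
            ENNReal.ofReal (p z * Real.exp (-(V (T x ω) z) + D (x + z))) else 0 := by
        intro z
        by_cases hz : (z : Zd d) ∈ R'
        · rw [if_pos hz, ENNReal.ofReal_mul (hp _ z.2), Real.exp_add,
            ENNReal.ofReal_mul (Real.exp_nonneg _), ← mul_assoc]
          by_cases h : x + (z : Zd d) = y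
          · simp [h, hD, cW]
          · simp only [h, if_false, add_zero]
            rw [← Finset.mul_sum]
            exact mul_le_mul_right (ih _ (Gp_add hx (Gp_mem hz))) _
        · rw [if_neg hz]
          have h1 := hy x hx z z.2 hz
          have h2 : x + (z : Zd d) ≠ y := by
            intro h
            apply h1
            rw [h, sub_self]
            exact Gp_zero R
          simp [h2, wT_eq_zero T V p R ω y _ _ h1]
      refine (Finset.sum_le_sum fun z _ => step z).trans ?_
      rw [Finset.sum_coe_sort R (fun z => if z ∈ R' then
            ENNReal.ofReal (p z * Real.exp (-(V (T x ω) z) + D (x + z))) else 0),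
        ← Finset.sum_filter, Finset.filter_mem_eq_inter, Finset.inter_eq_right.2 hR',
        ← ENNReal.ofReal_sum_of_nonneg
          fun z hz => mul_nonneg (hp z (hR' hz)) (Real.exp_nonneg _)]
      exact ENNReal.ofReal_le_ofReal (H x hx)
  have : walkK T V p R ω 0 y = ∑' n, wT T V p R ω y n 0 := rfl
  rw [this]
  exact ENNReal.tsum_le_of_sum_range_le fun N => key N 0 (Gp_zero _)

theorem walk_pos (T : Zd d → Ω → Ω) (V : Ω → Zd d → ℝ) (p : Zd d → ℝ) (R : Finset (Zd d))
    (hp : ∀ z ∈ R, 0 < p z) (ω : Ω) (y : Zd d) (hy : y ∈ Gp R) (hy0 : y ≠ 0) :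
    walkK T V p R ω 0 y ≠ 0 := by
  have ex : ∃ n : ℕ, ∃ f : ℕ → Zd d, (∀ i < n, f i ∈ R) ∧ pos 0 f n = y := by
    refine Gp_induction (R := R) (P := fun y => ∃ n : ℕ, ∃ f : ℕ → Zd d,
      (∀ i < n, f i ∈ R) ∧ pos 0 f n = y) ?_ ?_ hy
    · exact ⟨0, 0, by simp [pos]⟩
    · rintro x ⟨n, f, hf, rfl⟩ z hz
      refine ⟨n+1, fun i => if i = n then z else f i, ?_, ?_⟩
      · intro i hi
        by_cases h : i = n
        · simpa [h] using hz
        · simpa [h] using hf i (by omega)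
      · unfold pos
        rw [Finset.sum_range_succ]
        simp only [if_true]
        rw [add_assoc]
        congr 2
        refine Finset.sum_congr rfl fun i hi => ?_
        rw [if_neg (Finset.mem_range.1 hi).ne]
  obtain ⟨f, hf, hfy⟩ := Nat.find_spec ex
  have hmin := fun k (hk : k < Nat.find ex) => Nat.find_min ex hk
  revert hf hfy hmin
  generalize Nat.find ex = n
  intro hf hfy hmin
  rcases n with _ | n
  · exact absurd (by simpa [pos] using hfy.symm) hy0
  let s : Fin (n+1) → {z : Zd d // z ∈ R} := fun i => ⟨f i, hf i i.2⟩
  have hs : ∀ i < n+1, stepF (n+1) s i = f i := by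
    intro i hi
    simp [stepF, hi, s]
  have hpos : ∀ k ≤ n+1, pos 0 (stepF (n+1) s) k = pos 0 f k := by
    intro k hk
    unfold pos
    congr 1
    refine Finset.sum_congr rfl fun i hi => hs i ?_
    have := Finset.mem_range.1 hi
    omega
  have hfh : firstHit 0 y (n+1) (stepF (n+1) s) := by
    refine ⟨by rw [hpos _ le_rfl, hfy], fun k hk => ?_⟩
    have hk' := Finset.mem_Ioo.1 hk
    rw [hpos k (by omega)]
    intro h
    exact hmin k hk'.2 ⟨f, fun i hi => hf i (by omega), h⟩
  intro h0
  unfold walkK at h0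
  rw [ENNReal.tsum_eq_zero] at h0
  have h1 := Finset.sum_eq_zero_iff.1 (h0 n) s (Finset.mem_univ _)
  rw [if_pos hfh, mul_eq_zero] at h1
  rcases h1 with h1 | h1
  · unfold pathW at h1
    rw [Finset.prod_eq_zero_iff] at h1
    obtain ⟨i, -, hi⟩ := h1
    rw [ENNReal.ofReal_eq_zero] at hi
    exact absurd (hp _ (s i).2) (not_lt.2 hi)
  · rw [ENNReal.ofReal_eq_zero] at h1
    exact absurd (Real.exp_pos _) (not_lt.2 h1)

theorem toR_add (x y : Zd d) : toR (x + y) = toR x + toR y := by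
  funext i; simp [toR]

theorem toR_zero : toR (0 : Zd d) = 0 := by
  funext i; simp [toR]

theorem toR_nsmul (n : ℕ) (y : Zd d) : toR (n • y) = (n : ℝ) • toR y := by
  funext i; simp [toR]

theorem toR_sum {ι : Type*} (s : Finset ι) (f : ι → Zd d) :
    toR (∑ i ∈ s, f i) = ∑ i ∈ s, toR (f i) := by
  funext i; simp [toR]

theorem Cp_of_Gp {R : Finset (Zd d)} {x : Zd d} (hx : x ∈ Gp R) : toR x ∈ Cp R := by
  obtain ⟨b, rfl⟩ := hx
  exact ⟨fun z => b z, fun z => by positivity, by simp only [toR_sum, toR_nsmul]⟩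

theorem Cp_smul {R : Finset (Zd d)} {x : Fin d → ℝ} (hx : x ∈ Cp R) {t : ℝ} (ht : 0 ≤ t) :
    t • x ∈ Cp R := by
  obtain ⟨b, hb, rfl⟩ := hx
  exact ⟨fun z => t * b z, fun z => mul_nonneg ht (hb z), by simp [Finset.smul_sum, smul_smul]⟩

theorem face_zero {R : Finset (Zd d)} {A : Set (Fin d → ℝ)} (hA : IsFace (Cp R) A)
    (hne : A.Nonempty) : (0 : Fin d → ℝ) ∈ A := by
  obtain ⟨a, ha⟩ := hne
  have h0 : (0 : Fin d → ℝ) ∈ Cp R := ⟨0, by simp, by simp⟩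
  refine (hA.2.2 (ζ := (2:ℝ) • a) (η := 0) (t := 1/2) ha (Cp_smul (hA.1 ha) (by norm_num)) h0
    (by constructor <;> norm_num) ?_).2
  rw [smul_smul]; norm_num

theorem face_two {R : Finset (Zd d)} {A : Set (Fin d → ℝ)} (hA : IsFace (Cp R) A)
    {a : Fin d → ℝ} (ha : a ∈ A) : (2:ℝ) • a ∈ A := by
  have h0 : (0 : Fin d → ℝ) ∈ Cp R := ⟨0, by simp, by simp⟩
  refine (hA.2.2 (ζ := (2:ℝ) • a) (η := 0) (t := 1/2) ha (Cp_smul (hA.1 ha) (by norm_num)) h0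
    (by constructor <;> norm_num) ?_).1
  rw [smul_smul]; norm_num

theorem face_add {R : Finset (Zd d)} {A : Set (Fin d → ℝ)} (hA : IsFace (Cp R) A)
    {a b : Fin d → ℝ} (ha : a ∈ A) (hb : b ∈ A) : a + b ∈ A := by
  have := (convex_iff_forall_pos.1 hA.2.1) (face_two hA ha) (face_two hA hb)
    (show (0:ℝ) < 1/2 by norm_num) (show (0:ℝ) < 1/2 by norm_num) (by norm_num)
  rw [smul_smul, smul_smul] at this
  norm_num at this
  exact this

theorem face_left {R : Finset (Zd d)} {A : Set (Fin d → ℝ)} (hA : IsFace (Cp R) A)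
    {a b : Fin d → ℝ} (ha : a ∈ Cp R) (hb : b ∈ Cp R) (hab : a + b ∈ A) : a ∈ A := by
  have h2 : (2:ℝ) • a ∈ A := by
    refine (hA.2.2 (ζ := (2:ℝ) • a) (η := (2:ℝ) • b) (t := 1/2) hab
      (Cp_smul ha (by norm_num)) (Cp_smul hb (by norm_num))
      (by constructor <;> norm_num) ?_).1
    rw [smul_smul, smul_smul]; norm_num
  refine (hA.2.2 (ζ := a) (η := (3:ℝ) • a) (t := 1/2) h2
      ha (Cp_smul ha (by norm_num))
      (by constructor <;> norm_num) ?_).1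
  rw [smul_smul, ← add_smul]; norm_num

theorem face_Gp {R R' : Finset (Zd d)} {A : Set (Fin d → ℝ)} (hA : IsFace (Cp R) A)
    (hne : A.Nonempty) (hR' : ∀ z, z ∈ R' ↔ z ∈ R ∧ toR z ∈ A) {x : Zd d} (hx : x ∈ Gp R') :
    toR x ∈ A := by
  refine Gp_induction (R := R') (P := fun x => toR x ∈ A) ?_ ?_ hx
  · rw [toR_zero]; exact face_zero hA hne
  · intro x hx z hz
    rw [toR_add]
    exact face_add hA hx ((hR' z).1 hz).2

theorem face_excl {R R' : Finset (Zd d)} {A : Set (Fin d → ℝ)} (hA : IsFace (Cp R) A)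
    (hR' : ∀ z, z ∈ R' ↔ z ∈ R ∧ toR z ∈ A) {y : Zd d} (hy : toR y ∈ A) :
    ∀ x ∈ Gp R', ∀ z ∈ R, z ∉ R' → y - (x + z) ∉ Gp R := by
  intro x hx z hz hz' h
  apply hz'
  rw [hR']
  refine ⟨hz, ?_⟩
  have hxR : x ∈ Gp R := Gp_mono (fun w hw => ((hR' w).1 hw).1) hx
  refine face_left hA (b := toR (x + (y - (x + z)))) (Cp_of_Gp (Gp_mem hz))
    (Cp_of_Gp (Gp_add hxR h)) ?_
  rw [← toR_add]
  convert hy using 2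
  abel

end comb

section coc
variable {d : ℕ} {Ω : Type*} [MeasurableSpace Ω]

theorem invSigma_le (T : Zd d → Ω → Ω) (S : Set (Zd d)) :
    invSigma T S ≤ (inferInstance : MeasurableSpace Ω) := fun _ h => h.1

theorem condExp_shift (ℙ : Measure Ω) [IsProbabilityMeasure ℙ] (T : Zd d → Ω → Ω)
    (Tmp : ∀ z : Zd d, MeasurePreserving (T z) ℙ ℙ) (S : Set (Zd d)) {f : Ω → ℝ}
    (hf : Integrable f ℙ) {z : Zd d} (hz : z ∈ S) :
    ℙ[f | invSigma T S] =ᵐ[ℙ] ℙ[f ∘ T z | invSigma T S] := by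
  refine ae_eq_condExp_of_forall_setIntegral_eq (invSigma_le T S)
    ((Tmp z).integrable_comp_of_integrable hf) (fun s _ _ => integrable_condExp.integrableOn) ?_
    stronglyMeasurable_condExp.aestronglyMeasurable
  intro s hs _
  rw [setIntegral_condExp (invSigma_le T S) hf hs]
  have h1 : ∫ x in s, f x ∂ℙ = ∫ x in s, f x ∂(Measure.map (T z) ℙ) := by rw [(Tmp z).map_eq]
  rw [h1, setIntegral_map hs.1 (by rw [(Tmp z).map_eq]; exact hf.aestronglyMeasurable)
    (Tmp z).aemeasurable, hs.2 z hz]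
  rfl

theorem coc_add (ℙ : Measure Ω) (T : Zd d → Ω → Ω) (R' : Finset (Zd d))
    (B : Ω → Zd d → Zd d → ℝ) (hB : IsCocycle ℙ T (GZ R') B) :
    ∀ᵐ ω ∂ℙ, ∀ x ∈ GZ R', ∀ y ∈ GZ R', B ω 0 (x + y) = B ω 0 x + B (T x ω) 0 y := by
  filter_upwards [hB.2.2.1, hB.2.2.2] with ω h1 h2 x hx y hy
  have e1 := h1 0 (GZ_zero _) x hx (x + y) (GZ_add hx hy)
  have e2 := h2 0 (GZ_zero _) y hy x hx
  rw [zero_add, add_comm y x] at e2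
  rw [← e1, e2]

theorem b_add (ℙ : Measure Ω) [IsProbabilityMeasure ℙ] (T : Zd d → Ω → Ω)
    (Tmp : ∀ z : Zd d, MeasurePreserving (T z) ℙ ℙ) (R' : Finset (Zd d))
    (B : Ω → Zd d → Zd d → ℝ) (hB : IsCocycle ℙ T (GZ R') B) :
    ∀ᵐ ω ∂ℙ, ∀ x ∈ GZ R', ∀ y ∈ GZ R',
      (ℙ[fun ω' => B ω' 0 (x + y) | invSigma T (GZ R')]) ω =
        (ℙ[fun ω' => B ω' 0 x | invSigma T (GZ R')]) ω +
        (ℙ[fun ω' => B ω' 0 y | invSigma T (GZ R')]) ω := by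
  rw [ae_all_iff]; intro x
  rw [ae_all_iff]; intro hx
  rw [ae_all_iff]; intro y
  rw [ae_all_iff]; intro hy
  have ix := hB.2.1 0 (GZ_zero _) x hx
  have iy := hB.2.1 0 (GZ_zero _) y hy
  have h1 : (fun ω' => B ω' 0 (x + y)) =ᵐ[ℙ]
      (fun ω' => B ω' 0 x) + ((fun ω' => B ω' 0 y) ∘ T x) := by
    filter_upwards [coc_add ℙ T R' B hB] with ω h
    exact h x hx y hy
  have h2 := condExp_congr_ae (m := invSigma T (GZ R')) h1
  have h3 := condExp_add ix ((Tmp x).integrable_comp_of_integrable iy) (invSigma T (GZ R'))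
  have h4 := condExp_shift ℙ T Tmp (GZ R') iy hx
  filter_upwards [h2, h3, h4] with ω e2 e3 e4
  rw [e2, e3, Pi.add_apply, e4]

theorem b_nsmul (R' : Finset (Zd d)) (b : Zd d → ℝ)
    (hb : ∀ x ∈ GZ R', ∀ y ∈ GZ R', b (x + y) = b x + b y) (n : ℕ) {v : Zd d} (hv : v ∈ GZ R') :
    n • v ∈ GZ R' ∧ b (n • v) = n * b v := by
  induction n with
  | zero =>
    refine ⟨by simpa using GZ_zero R', ?_⟩
    have := hb 0 (GZ_zero _) 0 (GZ_zero _)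
    simp at this
    simp [this]
  | succ n ih =>
    rw [succ_nsmul]
    refine ⟨GZ_add ih.1 hv, ?_⟩
    rw [hb _ ih.1 _ hv, ih.2]
    push_cast
    ring

theorem b_sum (R' : Finset (Zd d)) (b : Zd d → ℝ)
    (hb : ∀ x ∈ GZ R', ∀ y ∈ GZ R', b (x + y) = b x + b y) (m : Zd d → ℕ) :
    b (∑ z ∈ R', m z • z) = ∑ z ∈ R', m z * b z := by
  have key : ∀ s : Finset (Zd d), s ⊆ R' → (∑ z ∈ s, m z • z) ∈ GZ R' ∧
      b (∑ z ∈ s, m z • z) = ∑ z ∈ s, m z * b z := by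
    intro s
    induction s using Finset.induction_on with
    | empty =>
      intro _
      refine ⟨by simpa using GZ_zero R', ?_⟩
      have := hb 0 (GZ_zero _) 0 (GZ_zero _)
      simp at this
      simp [this]
    | insert a s ha ih =>
      intro hs
      have h1 := ih fun i hi => hs (by simp [hi])
      have h2 := b_nsmul R' b hb (m a) (Gp_sub_GZ (Gp_mem (hs (Finset.mem_insert_self a s))))
      rw [Finset.sum_insert ha, Finset.sum_insert ha]
      exact ⟨GZ_add h2.1 h1.1, by rw [hb _ h2.1 _ h1.1, h2.2, h1.2]⟩
  exact (key R' subset_rfl).2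

theorem inv_aesm (ℙ : Measure Ω) (T : Zd d → Ω → Ω) (hT0 : T 0 = id)
    (hTadd : ∀ x y : Zd d, T (x + y) = T x ∘ T y)
    (hTm : ∀ z, Measurable (T z)) (R' : Finset (Zd d)) (L : Ω → ℝ) (hL : Measurable L)
    (hinv : ∀ z ∈ GZ R', ∀ᵐ ω ∂ℙ, L (T z ω) = L ω) :
    AEStronglyMeasurable[invSigma T (GZ R')] L ℙ := by
  set E : Set Ω := {ω | ∀ z ∈ GZ R', L (T z ω) = L ω} with hE
  have hEm : MeasurableSet E := by
    have : E = ⋂ z ∈ GZ R', {ω | L (T z ω) = L ω} := by ext; simp [hE]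
    rw [this]
    exact MeasurableSet.biInter (Set.to_countable _)
      fun z _ => measurableSet_eq_fun (hL.comp (hTm z)) hL
  have hEinv : ∀ w ∈ GZ R', ∀ ω, ω ∈ E → T w ω ∈ E := by
    intro w hw ω hω z hz
    have h1 : T z (T w ω) = T (z + w) ω := by rw [hTadd]; rfl
    rw [h1, hω _ (GZ_add hz hw), hω _ hw]
  have hEinv' : ∀ w ∈ GZ R', ∀ ω, T w ω ∈ E ↔ ω ∈ E := by
    intro w hw ω
    refine ⟨fun h => ?_, hEinv w hw ω⟩
    have h1 := hEinv (-w) (GZ_neg hw) _ h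
    have h2 : T (-w) (T w ω) = T (-w + w) ω := by rw [hTadd]; rfl
    rw [h2, neg_add_cancel, hT0] at h1
    exact h1
  have hL'inv : ∀ w ∈ GZ R', ∀ ω, E.indicator L (T w ω) = E.indicator L ω := by
    intro w hw ω
    by_cases h : ω ∈ E
    · rw [Set.indicator_of_mem h, Set.indicator_of_mem (hEinv w hw ω h), h w hw]
    · rw [Set.indicator_of_notMem h, Set.indicator_of_notMem (by rwa [hEinv' w hw])]
  have hL'm : Measurable (E.indicator L) := hL.indicator hEm
  have hL'I : Measurable[invSigma T (GZ R')] (E.indicator L) := by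
    intro s hs
    refine ⟨hL'm hs, fun z hz => ?_⟩
    ext ω
    simp only [Set.mem_preimage, hL'inv z hz]
  refine ⟨E.indicator L, hL'I.stronglyMeasurable, ?_⟩
  have : ∀ᵐ ω ∂ℙ, ω ∈ E := by
    have := (ae_ball_iff (Set.to_countable (GZ R'))).2 hinv
    exact this
  filter_upwards [this] with ω h
  rw [Set.indicator_of_mem h]

theorem b_freq (ℙ : Measure Ω) [IsProbabilityMeasure ℙ] (T : Zd d → Ω → Ω) (hT0 : T 0 = id)
    (hTadd : ∀ x y : Zd d, T (x + y) = T x ∘ T y)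
    (Tmp : ∀ z : Zd d, MeasurePreserving (T z) ℙ ℙ) (R' : Finset (Zd d))
    (B : Ω → Zd d → Zd d → ℝ) (hB : IsCocycle ℙ T (GZ R') B) {v : Zd d} (hv : v ∈ GZ R') :
    ∀ᵐ ω ∂ℙ, ∃ᶠ j : ℕ in atTop, B ω 0 (j • v) ≤
      j * ((ℙ[fun ω' => B ω' 0 v | invSigma T (GZ R')]) ω + 1) := by
  have hint : ∀ x ∈ GZ R', Integrable (fun ω => B ω 0 x) ℙ := fun x hx =>
    hB.2.1 0 (GZ_zero _) x hx
  let F : ∀ x ∈ GZ R', Lp ℝ 1 ℙ := fun x hx => (memLp_one_iff_integrable.2 (hint x hx)).toLp _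
  have hFc : ∀ x (hx : x ∈ GZ R'), (F x hx : Ω → ℝ) =ᵐ[ℙ] fun ω => B ω 0 x :=
    fun x hx => MemLp.coeFn_toLp _
  let K : Zd d → Lp ℝ 1 ℙ →+ Lp ℝ 1 ℙ := fun z => Lp.compMeasurePreserving (T z) (Tmp z)
  have hKs : ∀ z (c : ℝ) f, K z (c • f) = c • K z f := fun z c f =>
    (Lp.compMeasurePreservingₗ ℝ (T z) (Tmp z)).map_smul c f
  have hKn : ∀ z f, ‖K z f‖ = ‖f‖ := fun z f => Lp.norm_compMeasurePreserving f (Tmp z)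
  have hKc : ∀ z, Continuous (K z) := fun z => (Lp.isometry_compMeasurePreserving (Tmp z)).continuous
  have hFadd : ∀ x (hx : x ∈ GZ R') y (hy : y ∈ GZ R'),
      F (x + y) (GZ_add hx hy) = F x hx + K x (F y hy) := by
    intro x hx y hy
    apply Lp.ext
    have h1 := hFc _ (GZ_add hx hy)
    have h2 := Lp.coeFn_add (F x hx) (K x (F y hy))
    have h3 : (K x (F y hy) : Ω → ℝ) =ᵐ[ℙ] (F y hy) ∘ T x :=
      Lp.coeFn_compMeasurePreserving _ (Tmp x)
    have h4 := (Tmp x).quasiMeasurePreserving.ae_eq_comp (hFc y hy)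
    filter_upwards [h1, h2, h3, h4, hFc x hx, coc_add ℙ T R' B hB] with ω e1 e2 e3 e4 e5 e6
    rw [e1, e2, Pi.add_apply, e3, e4, e5, e6 x hx y hy]
    rfl
  have hnv : ∀ n : ℕ, n • v ∈ GZ R' := by
    intro n
    induction n with
    | zero => simpa using GZ_zero R'
    | succ n ih => rw [succ_nsmul]; exact GZ_add ih hv
  have hFcongr : ∀ x y (hx : x ∈ GZ R') (hy : y ∈ GZ R'), x = y → F x hx = F y hy := by
    rintro x y hx hy rfl; rfl
  have hFn : ∀ n : ℕ, F (n • v) (hnv n) = birkhoffSum (K v) _root_.id n (F v hv) := by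
    intro n
    induction n with
    | zero =>
      have h := hFadd 0 (GZ_zero _) 0 (GZ_zero _)
      have h' : K 0 (F 0 (GZ_zero R')) = 0 := by
        rw [hFcongr (0 + 0) 0 (GZ_add (GZ_zero R') (GZ_zero R')) (GZ_zero R') (add_zero _)] at h
        exact (left_eq_add.1 h)
      have h2 : F 0 (GZ_zero R') = 0 := by
        rw [← norm_eq_zero, ← hKn 0, h', norm_zero]
      rw [birkhoffSum_zero, hFcongr _ 0 (hnv 0) (GZ_zero R') (zero_nsmul v), h2]
    | succ n ih =>
      rw [hFcongr _ (v + n • v) (hnv (n+1)) (GZ_add hv (hnv n)) (succ_nsmul' v n), hFadd _ hv _ (hnv n), ih]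
      simp only [birkhoffSum, _root_.id, map_sum]
      rw [Finset.sum_range_succ', add_comm]
      congr 1
      refine Finset.sum_congr rfl fun k _ => ?_
      rw [Function.iterate_succ_apply']
  obtain ⟨L, hL⟩ := l1_ergodic ℙ (T v) (Tmp v) (F v hv)
  have hAv : ∀ n : ℕ, birkhoffAverage ℝ (K v) _root_.id n (F v hv) =
      (n : ℝ)⁻¹ • F (n • v) (hnv n) := by
    intro n; rw [hFn, birkhoffAverage]
  have hL1 : Tendsto (fun n : ℕ => (n : ℝ)⁻¹ • F (n • v) (hnv n)) atTop (𝓝 L) := by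
    refine hL.congr fun n => hAv n
  -- invariance
  have hKL : ∀ z ∈ GZ R', K z L = L := by
    intro z hz
    have t1 : Tendsto (fun n : ℕ => K z ((n : ℝ)⁻¹ • F (n • v) (hnv n))) atTop (𝓝 (K z L)) :=
      ((hKc z).tendsto L).comp hL1
    have t2 := t1.sub hL1
    have t3 : Tendsto (fun n : ℕ => K z ((n : ℝ)⁻¹ • F (n • v) (hnv n)) -
        (n : ℝ)⁻¹ • F (n • v) (hnv n)) atTop (𝓝 0) := by
      have t4 : Tendsto (fun n : ℕ => (n : ℝ)⁻¹ * (2 * ‖F z hz‖)) atTop (𝓝 0) := by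
        have := (tendsto_inv_atTop_nhds_zero_nat (𝕜 := ℝ)).mul_const (2 * ‖F z hz‖)
        simpa using this
      refine squeeze_zero_norm (fun n => ?_) t4
      have e1 := hFadd z hz _ (hnv n)
      have e2 := hFadd _ (hnv n) z hz
      rw [hFcongr (z + n • v) (n • v + z) (GZ_add hz (hnv n)) (GZ_add (hnv n) hz) (add_comm _ _), e2] at e1
      have e3 : K z (F (n • v) (hnv n)) - F (n • v) (hnv n) = K (n • v) (F z hz) - F z hz := by
        rw [sub_eq_sub_iff_add_eq_add, add_comm, ← e1, add_comm]
      rw [hKs, ← smul_sub, e3, norm_smul, Real.norm_of_nonneg (by positivity)]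
      refine mul_le_mul_of_nonneg_left ?_ (by positivity)
      refine (norm_sub_le _ _).trans ?_
      rw [hKn]; linarith
    exact sub_eq_zero.1 (tendsto_nhds_unique t2 t3)
  have hinv : ∀ z ∈ GZ R', ∀ᵐ ω ∂ℙ, L (T z ω) = L ω := by
    intro z hz
    have h3 : (K z L : Ω → ℝ) =ᵐ[ℙ] L ∘ T z := Lp.coeFn_compMeasurePreserving _ (Tmp z)
    rw [hKL z hz] at h3
    filter_upwards [h3] with ω h
    exact h.symm
  have hsm := inv_aesm ℙ T hT0 hTadd (fun z => (Tmp z).measurable) R' L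
    (Lp.stronglyMeasurable L).measurable hinv
  have hLi : Integrable L ℙ := L1.integrable_coeFn L
  have hLc : ℙ[L | invSigma T (GZ R')] =ᵐ[ℙ] L :=
    condExp_of_aestronglyMeasurable' (invSigma_le T _) hsm hLi
  set b : Ω → ℝ := ℙ[fun ω' => B ω' 0 v | invSigma T (GZ R')] with hbdef
  have hbn : ∀ n : ℕ, n ≠ 0 → b - (L : Ω → ℝ) =ᵐ[ℙ]
      ℙ[((n : ℝ)⁻¹ • F (n • v) (hnv n) - L : Lp ℝ 1 ℙ) | invSigma T (GZ R')] := by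
    intro n hn
    have h1 : (((n : ℝ)⁻¹ • F (n • v) (hnv n) - L : Lp ℝ 1 ℙ) : Ω → ℝ) =ᵐ[ℙ]
        ((n : ℝ)⁻¹ • (fun ω => B ω 0 (n • v))) - (L : Ω → ℝ) := by
      filter_upwards [Lp.coeFn_sub ((n : ℝ)⁻¹ • F (n • v) (hnv n)) L,
        Lp.coeFn_smul (n : ℝ)⁻¹ (F (n • v) (hnv n)), hFc _ (hnv n)] with ω e1 e2 e3
      rw [e1, Pi.sub_apply, e2, Pi.smul_apply, e3]
      rfl
    have h2 := condExp_congr_ae (m := invSigma T (GZ R')) h1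
    have h3 := condExp_sub ((hint _ (hnv n)).smul (n : ℝ)⁻¹) hLi (invSigma T (GZ R'))
    have h4 := condExp_smul (μ := ℙ) (n : ℝ)⁻¹ (fun ω => B ω 0 (n • v)) (invSigma T (GZ R'))
    filter_upwards [h2, h3, h4, hLc, b_add ℙ T Tmp R' B hB] with ω e2 e3 e4 e5 e6
    rw [Pi.sub_apply, e2, e3, Pi.sub_apply, e4, e5, Pi.smul_apply]
    have := (b_nsmul R' (fun x => (ℙ[fun ω' => B ω' 0 x | invSigma T (GZ R')]) ω) e6 n hv).2
    rw [this, smul_eq_mul, inv_mul_cancel_left₀ (by exact_mod_cast hn)]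
  have hbL : b =ᵐ[ℙ] L := by
    have hle : ∀ n : ℕ, n ≠ 0 → eLpNorm (b - (L : Ω → ℝ)) 1 ℙ ≤
        ENNReal.ofReal ‖(n : ℝ)⁻¹ • F (n • v) (hnv n) - L‖ := by
      intro n hn
      rw [eLpNorm_congr_ae (hbn n hn)]
      refine (eLpNorm_condExp_le_eLpNorm _ le_rfl).trans ?_
      rw [Lp.norm_def, ENNReal.ofReal_toReal (Lp.eLpNorm_ne_top _)]
    have hlim : Tendsto (fun n : ℕ => ENNReal.ofReal ‖(n : ℝ)⁻¹ • F (n • v) (hnv n) - L‖)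
        atTop (𝓝 0) := by
      have := (hL1.sub_const L).norm
      rw [sub_self, norm_zero] at this
      have := ENNReal.tendsto_ofReal this
      rwa [ENNReal.ofReal_zero] at this
    have h0 : eLpNorm (b - (L : Ω → ℝ)) 1 ℙ ≤ 0 :=
      ge_of_tendsto hlim ((eventually_ne_atTop 0).mono fun n hn => hle n hn)
    have hbi : Integrable b ℙ := integrable_condExp
    have h1 := (eLpNorm_eq_zero_iff (hbi.sub hLi).aestronglyMeasurable (by simp)).1
      (le_antisymm h0 bot_le)
    filter_upwards [h1] with ω h
    simpa [sub_eq_zero] using h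
  obtain ⟨ns, hns, hae⟩ := (tendstoInMeasure_of_tendsto_Lp hL1).exists_seq_tendsto_ae
  have hco : ∀ᵐ ω ∂ℙ, ∀ n : ℕ, (((n : ℝ)⁻¹ • F (n • v) (hnv n) : Lp ℝ 1 ℙ) : Ω → ℝ) ω =
      (n : ℝ)⁻¹ * B ω 0 (n • v) := by
    rw [ae_all_iff]
    intro n
    filter_upwards [Lp.coeFn_smul (n : ℝ)⁻¹ (F (n • v) (hnv n)), hFc _ (hnv n)] with ω e2 e3
    rw [e2, Pi.smul_apply, e3]
    rfl
  filter_upwards [hae, hco, hbL] with ω e1 e2 e3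
  have ev := (e1.eventually_lt_const (show L ω < b ω + 1 by rw [e3]; linarith)).and
    (hns.tendsto_atTop.eventually_gt_atTop 0)
  refine hns.tendsto_atTop.frequently (ev.mono fun k hk => ?_).frequently
  rw [e2] at hk
  have hpos : (0:ℝ) < ns k := by exact_mod_cast hk.2
  have h5 := hk.1
  rw [inv_mul_lt_iff₀ hpos] at h5
  exact h5.le

end coc

end RWRPProof


open RWRP in
/-- lower bound in the cocycle variational formula. -/
theorem statement3
    {d : ℕ} {Ω : Type*} [MeasurableSpace Ω]
    (ℙ : Measure Ω) [IsProbabilityMeasure ℙ]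
    (T : Zd d → Ω → Ω) (R : Finset (Zd d)) (V : Ω → Zd d → ℝ) (p : Zd d → ℝ)
    (hset : Setting ℙ T R V p)
    (hV1 : VplusL1 ℙ V R)
    (U₀ : Set (Fin d → ℝ)) (hU₀ : IsZeroFace R U₀)
    (hi : AssumptionI ℙ V R U₀)
    (A : Set (Fin d → ℝ)) (hA : IsFace (Cp R) A) (hAne : A ≠ {0})
    (R' : Finset (Zd d)) (hR' : ∀ z, z ∈ R' ↔ z ∈ R ∧ toR z ∈ A)
    (hL : ∀ z ∈ R', z ≠ 0 → classL ℙ T (fun ω => max (V ω z) 0) z R')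
    (hL0 : ∃ zh ∈ R', zh ≠ 0 ∧ classL ℙ T (fun ω => max (V ω 0) 0) zh R')
    (α : Ω → (Fin d → ℝ) → ℝ)
    (hα : ∀ᵐ ω ∂ℙ, ∀ ξ ∈ intrinsicInterior ℝ A, ∀ x : ℕ → Zd d,
      (∀ n, x n ∈ Gp R ∧ toR (x n) ∈ A) →
      Tendsto (fun n : ℕ => (n : ℝ)⁻¹ • toR (x n)) atTop (𝓝 ξ) →
      Tendsto (fun n : ℕ => aFun T V p R ω 0 (x n) / n) atTop (𝓝 (α ω ξ)))
    (B : Ω → Zd d → Zd d → ℝ) (hB : InKplus ℙ T V p R' B) :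
    ∀ᵐ ω ∂ℙ, ∀ ξ ∈ intrinsicInterior ℝ A, ∀ γ : Zd d → ℝ,
      (∀ z, 0 ≤ γ z) → (∑ z ∈ R', γ z • toR z = ξ) →
      - ∑ z ∈ R', γ z *
          (MeasureTheory.condExp (invSigma T (GZ R')) ℙ (fun ω' => B ω' 0 z) ω) ≤
        α ω ξ := by
  obtain ⟨hTm, hT0, hTadd, Tmp, -, hVm, hp, -⟩ := hset
  have hRR : R' ⊆ R := fun z hz => ((hR' z).1 hz).1
  have hshift : ∀ᵐ ω ∂ℙ, ∀ x : Zd d,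
      ∑ z ∈ R', p z * Real.exp (-(V (T x ω) z) - B (T x ω) 0 z) ≤ 1 := by
    rw [ae_all_iff]
    intro x
    exact (Tmp x).quasiMeasurePreserving.ae hB.2
  have hfreq : ∀ᵐ ω ∂ℙ, ∀ v ∈ GZ R', ∃ᶠ j : ℕ in atTop, B ω 0 (j • v) ≤
      j * ((MeasureTheory.condExp (invSigma T (GZ R')) ℙ (fun ω' => B ω' 0 v)) ω + 1) := by
    rw [ae_all_iff]; intro v
    rw [ae_all_iff]; intro hv
    exact RWRPProof.b_freq ℙ T hT0 hTadd Tmp R' B hB.1 hv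
  filter_upwards [hα, hshift, hfreq, RWRPProof.b_add ℙ T Tmp R' B hB.1, hB.1.2.2.1, hB.1.2.2.2]
    with ω hαω hH hfr hbadd hc1 hc2 ξ hξ γ hγ hsum
  set b : Zd d → ℝ := fun z =>
    (MeasureTheory.condExp (invSigma T (GZ R')) ℙ (fun ω' => B ω' 0 z)) ω with hb
  have hne : A.Nonempty := ⟨ξ, intrinsicInterior_subset hξ⟩
  have hlow : ∀ y ∈ Gp R', - B ω 0 y ≤ aFun T V p R ω 0 y := by
    intro y hy
    have hyG := RWRPProof.Gp_sub_GZ hy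
    by_cases hy0 : y = 0
    · subst hy0
      have := hc1 0 hyG 0 hyG 0 hyG
      simp only [aFun, if_true]
      linarith
    · have hbd := RWRPProof.walk_bound T V p R R' hRR (fun z hz => (hp z hz).1.le) ω y
        (RWRPProof.face_excl hA hR' (RWRPProof.face_Gp hA hne hR' hy))
        (fun x => B ω x y) (by have := hc1 y hyG y hyG y hyG; linarith) (by
          intro x hx
          have hxG := RWRPProof.Gp_sub_GZ hx
          have h1 : ∀ z ∈ R', p z * Real.exp (-(V (T x ω) z) + B ω (x + z) y) =
              (p z * Real.exp (-(V (T x ω) z) - B (T x ω) 0 z)) * Real.exp (B ω x y) := by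
            intro z hz
            have hzG := RWRPProof.Gp_sub_GZ (RWRPProof.Gp_mem hz)
            have e1 := hc1 x hxG (x + z) (RWRPProof.GZ_add hxG hzG) y hyG
            have e2 := hc2 0 (RWRPProof.GZ_zero R') z hzG x hxG
            rw [zero_add, add_comm z x] at e2
            rw [mul_assoc, ← Real.exp_add]
            congr 2
            linarith
          rw [Finset.sum_congr rfl h1, ← Finset.sum_mul]
          have := mul_le_mul_of_nonneg_right (hH x) (Real.exp_nonneg (B ω x y))
          linarith)
      have hpos := RWRPProof.walk_pos T V p R (fun z hz => (hp z hz).1) ω y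
        (RWRPProof.Gp_mono hRR hy) hy0
      simp only [aFun, if_neg hy0]
      have hfin : walkK T V p R ω 0 y ≠ ⊤ := (hbd.trans_lt ENNReal.ofReal_lt_top).ne
      have h2 := ENNReal.toReal_mono ENNReal.ofReal_ne_top hbd
      rw [ENNReal.toReal_ofReal (Real.exp_nonneg _)] at h2
      have h3 := Real.log_le_log (ENNReal.toReal_pos hpos hfin) h2
      rw [Real.log_exp] at h3
      linarith
  let v : ℕ → Zd d := fun k => ∑ z ∈ R', ⌊γ z * k⌋₊ • z
  have hv : ∀ k, v k ∈ Gp R' := fun k => ⟨fun z => ⌊γ z * k⌋₊, rfl⟩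
  have hfl : ∀ z, Tendsto (fun k : ℕ => (⌊γ z * k⌋₊ : ℝ) / (k : ℝ)) atTop (𝓝 (γ z)) := fun z =>
    (tendsto_nat_floor_mul_div_atTop (hγ z)).comp tendsto_natCast_atTop_atTop
  have hu : Tendsto (fun k : ℕ => (k : ℝ)⁻¹ • toR (v k)) atTop (𝓝 ξ) := by
    rw [← hsum]
    have : Tendsto (fun k : ℕ => ∑ z ∈ R', ((⌊γ z * k⌋₊ : ℝ) / (k : ℝ)) • toR z) atTop
        (𝓝 (∑ z ∈ R', γ z • toR z)) :=
      tendsto_finsetSum _ fun z _ => (hfl z).smul_const _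
    refine this.congr fun k => ?_
    simp only [v, RWRPProof.toR_sum, RWRPProof.toR_nsmul, Finset.smul_sum, smul_smul]
    refine Finset.sum_congr rfl fun z _ => ?_
    rw [div_eq_inv_mul]
  have hbv : Tendsto (fun k : ℕ => (b (v k) + 1) / (k : ℝ)) atTop (𝓝 (∑ z ∈ R', γ z * b z)) := by
    have h1 : Tendsto (fun k : ℕ => ∑ z ∈ R', ((⌊γ z * k⌋₊ : ℝ) / (k : ℝ)) * b z) atTop
        (𝓝 (∑ z ∈ R', γ z * b z)) :=
      tendsto_finsetSum _ fun z _ => (hfl z).mul_const _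
    have h2 := h1.add (tendsto_inv_atTop_nhds_zero_nat (𝕜 := ℝ))
    rw [add_zero] at h2
    refine h2.congr fun k => ?_
    rw [show b (v k) = ∑ z ∈ R', (⌊γ z * k⌋₊ : ℝ) * b z from
      RWRPProof.b_sum R' b hbadd (fun z => ⌊γ z * k⌋₊), add_div, Finset.sum_div, one_div]
    congr 1
    refine Finset.sum_congr rfl fun z _ => ?_
    ring
  have hext : ∀ k : ℕ, ∃ᶠ n : ℕ in atTop, ∃ j : ℕ, n = j * (k + 1) ∧
      B ω 0 (j • v (k+1)) ≤ j * (b (v (k+1)) + 1) := by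
    intro k
    have h1 := hfr (v (k+1)) (RWRPProof.Gp_sub_GZ (hv _))
    have h2 : Tendsto (fun j : ℕ => j * (k+1)) atTop atTop :=
      tendsto_id.atTop_mul_const' (Nat.succ_pos k)
    exact h2.frequently (h1.mono fun j hj => ⟨j, rfl, hj⟩)
  obtain ⟨φ, hφ, hφP⟩ := extraction_forall_of_frequently hext
  let σ : ℕ → ℕ := Function.extend φ (fun k => k + 1) id
  have hσφ : ∀ k, σ (φ k) = k + 1 := fun k => hφ.injective.extend_apply _ _ k
  have hσo : ∀ n, (¬ ∃ k, φ k = n) → σ n = n := fun n hn => Function.extend_apply' _ _ _ hn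
  have hσd : ∀ n, n / σ n * σ n = n := by
    intro n
    by_cases h : ∃ k, φ k = n
    · obtain ⟨k, rfl⟩ := h
      rw [hσφ]
      obtain ⟨j, hj, -⟩ := hφP k
      rw [hj, Nat.mul_div_cancel _ (Nat.succ_pos k)]
    · rw [hσo n h]
      rcases Nat.eq_zero_or_pos n with h0 | h0
      · subst h0; simp
      · rw [Nat.div_self h0, one_mul]
  have hσt : Tendsto σ atTop atTop := by
    rw [tendsto_atTop]
    intro M
    filter_upwards [eventually_ge_atTop M, eventually_ge_atTop (φ M)] with n h1 h2
    by_cases h : ∃ k, φ k = n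
    · obtain ⟨k, rfl⟩ := h
      rw [hσφ]
      have := hφ.le_iff_le.1 h2
      omega
    · rw [hσo n h]; exact h1
  let x : ℕ → Zd d := fun n => (n / σ n) • v (σ n)
  have hxG : ∀ n, x n ∈ Gp R' := fun n => RWRPProof.Gp_nsmul (hv _) _
  have hxt : Tendsto (fun n : ℕ => (n : ℝ)⁻¹ • toR (x n)) atTop (𝓝 ξ) := by
    refine (hu.comp hσt).congr' ?_
    filter_upwards [eventually_gt_atTop 0] with n hn
    simp only [Function.comp, x, RWRPProof.toR_nsmul, smul_smul]
    congr 1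
    have h1 := hσd n
    generalize n / σ n = q at h1 ⊢
    generalize σ n = s at h1 ⊢
    subst h1
    have hq : (q : ℝ) ≠ 0 := by
      rintro h
      have : q = 0 := by exact_mod_cast h
      simp [this] at hn
    push_cast
    rw [mul_inv]
    field_simp
  have hlim := hαω ξ hξ x (fun n => ⟨RWRPProof.Gp_mono hRR (hxG n),
    RWRPProof.face_Gp hA hne hR' (hxG n)⟩) hxt
  have hlim2 := hlim.comp hφ.tendsto_atTop
  have hlim3 := (hbv.comp (tendsto_add_atTop_nat 1)).neg
  refine le_of_tendsto_of_tendsto hlim3 hlim2 ?_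
  filter_upwards [eventually_gt_atTop 0] with k hk
  simp only [Function.comp]
  obtain ⟨j, hj, hjB⟩ := hφP k
  have hxk : x (φ k) = j • v (k+1) := by
    simp only [x, hσφ]
    rw [hj, Nat.mul_div_cancel _ (Nat.succ_pos k)]
  have hφk : 0 < φ k := lt_of_lt_of_le hk (hφ.id_le k)
  have hj0 : 0 < j := by
    rcases Nat.eq_zero_or_pos j with h | h
    · rw [h, zero_mul] at hj; omega
    · exact h
  have hjr : (0:ℝ) < j := by exact_mod_cast hj0
  have h5 := hlow _ (hxG (φ k))
  rw [hxk] at h5 ⊢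
  rw [hj]
  have hk1 : (0:ℝ) < ((k + 1 : ℕ) : ℝ) := by positivity
  rw [← neg_div, Nat.cast_mul, div_le_div_iff₀ hk1 (mul_pos hjr hk1)]
  nlinarith
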